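/- arXiv:2601.05455 — 2 statements merged into one kernel-verified Lean document; each statement's English description precedes it below -/
import Mathlib

section
/- MM minorization for the bipartite Bradley–Terry log-likelihood: for every θ₀ with θ₀(u) > 0 for all u and every θ with θ(u) > 0 for all u, L(θ) − L(θ₀) ≥ Q(θ | θ₀) − Q(θ₀ | θ₀), where Q(θ | θ₀) = Σ_{u} wins(u) · log θ(u) − Σ_{u} θ(u) · c_{θ₀}(u); in particular the bound is tight at θ = θ₀. -/
open Real

variable {A B : Type*}

/-- Bipartite Bradley–Terry log-likelihood: `w a b` counts wins of supporter `a` over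
attacker `b`, `l a b` counts wins of `b` over `a`, and `θ` assigns positive strengths to
elements of `A ⊕ B`. -/
noncomputable def btLogLik [Fintype A] [Fintype B]
    (θ : A ⊕ B → ℝ) (w l : A → B → ℝ) : ℝ :=
  (∑ a : A, ∑ b : B, (w a b * Real.log (θ (Sum.inl a)) + l a b * Real.log (θ (Sum.inr b))))
    - ∑ a : A, ∑ b : B, (w a b + l a b) * Real.log (θ (Sum.inl a) + θ (Sum.inr b))

/-- Total wins of each element: `wins(a) = Σ_b w a b` for a supporter `a`, and
`wins(b) = Σ_a l a b` for an attacker `b`. -/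
noncomputable def btWins [Fintype A] [Fintype B] (w l : A → B → ℝ) : A ⊕ B → ℝ :=
  Sum.elim (fun a => ∑ b : B, w a b) (fun b => ∑ a : A, l a b)

/-- MM denominator: `c_θ(u) = Σ n_{uv} / (θ u + θ v)` over cross-pairs containing `u`,
where `n a b = w a b + l a b`. -/
noncomputable def btDenom [Fintype A] [Fintype B]
    (w l : A → B → ℝ) (θ : A ⊕ B → ℝ) : A ⊕ B → ℝ :=
  Sum.elim
    (fun a => ∑ b : B, (w a b + l a b) / (θ (Sum.inl a) + θ (Sum.inr b)))
    (fun b => ∑ a : A, (w a b + l a b) / (θ (Sum.inl a) + θ (Sum.inr b)))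

/-- MM minorizing surrogate `Q(θ | θ₀)`. -/
noncomputable def btSurrogate [Fintype A] [Fintype B]
    (w l : A → B → ℝ) (θ θ₀ : A ⊕ B → ℝ) : ℝ :=
  (∑ u : A ⊕ B, btWins w l u * Real.log (θ u)) - ∑ u : A ⊕ B, θ u * btDenom w l θ₀ u

/-- The surrogate as a single sum over the compared pairs. -/
theorem btSurrogate_eq_sum [Fintype A] [Fintype B]
    (w l : A → B → ℝ) (θ θ₀ : A ⊕ B → ℝ) :
    btSurrogate w l θ θ₀ =
      ∑ a : A, ∑ b : B,
        (w a b * Real.log (θ (Sum.inl a)) + l a b * Real.log (θ (Sum.inr b))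
          - (w a b + l a b) * ((θ (Sum.inl a) + θ (Sum.inr b)) /
            (θ₀ (Sum.inl a) + θ₀ (Sum.inr b)))) := by
  simp only [btSurrogate, btWins, btDenom, Fintype.sum_sum_type, Sum.elim_inl, Sum.elim_inr,
    Finset.sum_mul, Finset.mul_sum]
  rw [Finset.sum_comm (f := fun (b : B) (a : A) => l a b * Real.log (θ (Sum.inr b))),
    Finset.sum_comm (f := fun (b : B) (a : A) => θ (Sum.inr b) *
      ((w a b + l a b) / (θ₀ (Sum.inl a) + θ₀ (Sum.inr b))))]
  simp only [← Finset.sum_add_distrib, ← Finset.sum_sub_distrib]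
  refine Finset.sum_congr rfl fun a _ => Finset.sum_congr rfl fun b _ => ?_
  ring

/-- The tangent-line bound for the logarithm at `s`. -/
theorem log_sub_log_le_div_sub_one {s t : ℝ} (hs : 0 < s) (ht : 0 < t) :
    Real.log t - Real.log s ≤ t / s - 1 := by
  rw [← Real.log_div ht.ne' hs.ne']
  exact Real.log_le_sub_one_of_pos (div_pos ht hs)

/-- MM minorization: for positive `θ₀` and `θ`,
`L(θ) − L(θ₀) ≥ Q(θ | θ₀) − Q(θ₀ | θ₀)` (the bound is tight at `θ = θ₀` since both sides
vanish there). -/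
theorem btMM_minorization [Fintype A] [Fintype B]
    (w l : A → B → ℝ) (hw : ∀ a b, 0 ≤ w a b) (hl : ∀ a b, 0 ≤ l a b)
    (θ₀ θ : A ⊕ B → ℝ) (hθ₀ : ∀ u, 0 < θ₀ u) (hθ : ∀ u, 0 < θ u) :
    btSurrogate w l θ θ₀ - btSurrogate w l θ₀ θ₀ ≤ btLogLik θ w l - btLogLik θ₀ w l := by
  rw [btSurrogate_eq_sum, btSurrogate_eq_sum]
  simp only [btLogLik, ← Finset.sum_sub_distrib]
  refine Finset.sum_le_sum fun a _ => Finset.sum_le_sum fun b _ => ?_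
  have hs := add_pos (hθ₀ (Sum.inl a)) (hθ₀ (Sum.inr b))
  have ht := add_pos (hθ (Sum.inl a)) (hθ (Sum.inr b))
  rw [div_self hs.ne']
  linarith [mul_le_mul_of_nonneg_left (log_sub_log_le_div_sub_one hs ht)
    (add_nonneg (hw a b) (hl a b))]
end

section
/- Monotone ascent of the MM/Bradley–Terry update: suppose θ₀ satisfies θ₀(u) > 0 for all u, and wins(u) > 0 and c_{θ₀}(u) > 0 for every u ∈ A ⊕ B. Let θ̃(u) = wins(u) / c_{θ₀}(u) and let θ₁ be θ̃ normalized so that Σ_{u} θ₁(u) = 1 (i.e., θ₁ = θ̃ / Σ_u θ̃(u)). Then L(θ₁) ≥ L(θ₀). -/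
open Real

variable {A B : Type*}

theorem sum_btWins_mul [Fintype A] [Fintype B] (w l : A → B → ℝ) (f : A ⊕ B → ℝ) :
    ∑ u, btWins w l u * f u = ∑ a, ∑ b, (w a b * f (Sum.inl a) + l a b * f (Sum.inr b)) := by
  simp only [Fintype.sum_sum_type, btWins, Sum.elim_inl, Sum.elim_inr, Finset.sum_mul,
    Finset.sum_add_distrib]
  rw [Finset.sum_comm (f := fun b a => l a b * f (Sum.inr b))]

theorem sum_mul_btDenom [Fintype A] [Fintype B] (w l : A → B → ℝ) (θ θ₀ : A ⊕ B → ℝ) :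
    ∑ u, θ u * btDenom w l θ₀ u = ∑ a, ∑ b, (w a b + l a b) *
      ((θ (Sum.inl a) + θ (Sum.inr b)) / (θ₀ (Sum.inl a) + θ₀ (Sum.inr b))) := by
  simp only [Fintype.sum_sum_type, btDenom, Sum.elim_inl, Sum.elim_inr, Finset.mul_sum]
  rw [Finset.sum_comm (s := (Finset.univ : Finset B))]
  simp only [← Finset.sum_add_distrib]
  refine Finset.sum_congr rfl fun a _ => Finset.sum_congr rfl fun b _ => ?_
  ring

/-- The log-likelihood is invariant under rescaling of the strengths. -/
theorem btLogLik_div_const [Fintype A] [Fintype B] (w l : A → B → ℝ) {θ : A ⊕ B → ℝ}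
    (hθ : ∀ u, 0 < θ u) {c : ℝ} (hc : 0 < c) :
    btLogLik (fun u => θ u / c) w l = btLogLik θ w l := by
  simp only [btLogLik, ← Finset.sum_sub_distrib]
  refine Finset.sum_congr rfl fun a _ => Finset.sum_congr rfl fun b _ => ?_
  have ha := hθ (Sum.inl a)
  have hb := hθ (Sum.inr b)
  rw [← add_div, Real.log_div ha.ne' hc.ne', Real.log_div hb.ne' hc.ne',
    Real.log_div (add_pos ha hb).ne' hc.ne']
  ring

/-- Up to a constant, the surrogate minorizes the log-likelihood, with equality at `θ₀`. -/
theorem btSurrogate_sub_le_btLogLik_sub [Fintype A] [Fintype B] {w l : A → B → ℝ}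
    (hw : ∀ a b, 0 ≤ w a b) (hl : ∀ a b, 0 ≤ l a b) {θ θ₀ : A ⊕ B → ℝ}
    (hθ : ∀ u, 0 < θ u) (hθ₀ : ∀ u, 0 < θ₀ u) :
    btSurrogate w l θ θ₀ - btSurrogate w l θ₀ θ₀ ≤ btLogLik θ w l - btLogLik θ₀ w l := by
  simp only [btSurrogate, btLogLik, sum_mul_btDenom]
  rw [sum_btWins_mul w l fun u => Real.log (θ u), sum_btWins_mul w l fun u => Real.log (θ₀ u)]
  simp only [← Finset.sum_sub_distrib]
  refine Finset.sum_le_sum fun a _ => Finset.sum_le_sum fun b _ => ?_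
  have h := add_pos (hθ (Sum.inl a)) (hθ (Sum.inr b))
  have h₀ := add_pos (hθ₀ (Sum.inl a)) (hθ₀ (Sum.inr b))
  have key := mul_le_mul_of_nonneg_left (Real.log_le_sub_one_of_pos (div_pos h h₀))
    (add_nonneg (hw a b) (hl a b))
  rw [Real.log_div h.ne' h₀.ne'] at key
  rw [div_self h₀.ne']
  linarith

theorem mul_log_sub_mul_le {W c x : ℝ} (hW : 0 < W) (hc : 0 < c) (hx : 0 < x) :
    W * Real.log x - x * c ≤ W * Real.log (W / c) - W / c * c := by
  have hWc := div_pos hW hc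
  have key := mul_le_mul_of_nonneg_left (Real.log_le_sub_one_of_pos (div_pos hx hWc)) hW.le
  rw [Real.log_div hx.ne' hWc.ne'] at key
  have h : W * (x / (W / c) - 1) = x * c - W / c * c := by field_simp
  linarith

/-- The MM update maximizes the surrogate. -/
theorem btSurrogate_le_update [Fintype A] [Fintype B] {w l : A → B → ℝ} {θ θ₀ : A ⊕ B → ℝ}
    (hθ : ∀ u, 0 < θ u) (hwins : ∀ u, 0 < btWins w l u) (hden : ∀ u, 0 < btDenom w l θ₀ u) :
    btSurrogate w l θ θ₀ ≤ btSurrogate w l (fun u => btWins w l u / btDenom w l θ₀ u) θ₀ := by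
  simp only [btSurrogate, ← Finset.sum_sub_distrib]
  exact Finset.sum_le_sum fun u _ => mul_log_sub_mul_le (hwins u) (hden u) (hθ u)

/-- Monotone ascent of the MM/Bradley–Terry update: with `θ̃(u) = wins(u)/c_{θ₀}(u)` and
`θ₁ = θ̃ / Σ_u θ̃(u)` (normalized to sum to one), we have `L(θ₁) ≥ L(θ₀)`. -/
theorem btMM_monotone_ascent [Fintype A] [Fintype B]
    (w l : A → B → ℝ) (hw : ∀ a b, 0 ≤ w a b) (hl : ∀ a b, 0 ≤ l a b)
    (θ₀ : A ⊕ B → ℝ) (hθ₀ : ∀ u, 0 < θ₀ u)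
    (hwins : ∀ u, 0 < btWins w l u) (hden : ∀ u, 0 < btDenom w l θ₀ u)
    (θtilde θ₁ : A ⊕ B → ℝ)
    (hθtilde : θtilde = fun u => btWins w l u / btDenom w l θ₀ u)
    (hθ₁ : θ₁ = fun u => θtilde u / ∑ v : A ⊕ B, θtilde v) :
    btLogLik θ₀ w l ≤ btLogLik θ₁ w l := by
  have hpos : ∀ u, 0 < btWins w l u / btDenom w l θ₀ u := fun u => div_pos (hwins u) (hden u)
  subst hθtilde hθ₁
  rcases isEmpty_or_nonempty A with hA | hA
  · simp [btLogLik]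
  · rw [btLogLik_div_const w l hpos (Finset.sum_pos (fun u _ => hpos u) Finset.univ_nonempty)]
    linarith [btSurrogate_sub_le_btLogLik_sub hw hl hpos hθ₀,
      btSurrogate_le_update hθ₀ hwins hden]
end
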